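/- Let d = 3. There exists a constant c > 0 such that for every x ∈ Z^3, every simple random walk X on Z^3 with X(0) = x, and every positive integer T: P[ cap({X(t) : 1 ≤ t ≤ T}) ≥ c T^{1/2} ] ≥ c. -/

import Mathlib

open MeasureTheory ProbabilityTheory
open scoped ENNReal NNReal

/-- Points of the lattice `ℤ^d`. -/
abbrev Zd (d : ℕ) := Fin d → ℤ

/-- The `ℓ^∞` norm of a lattice point. -/
def norminf {d : ℕ} (x : Zd d) : ℕ := Finset.univ.sup fun j => (x j).natAbs

/-- `x` and `y` are nearest neighbours in `ℤ^d` (their `ℓ^1` distance is `1`). -/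
def IsStep {d : ℕ} (x y : Zd d) : Prop := (∑ j, (y j - x j).natAbs) = 1

/-- Discrete ball (in `ℤ^d`, `ℓ^∞` distance) with real center and radius. -/
def ballZR (d : ℕ) (c : Fin d → ℝ) (r : ℝ) : Set (Zd d) :=
  {y | ∀ j, |(y j : ℝ) - c j| ≤ r}

/-- `t`-step transition probability of simple random walk on `ℤ^d`. -/
noncomputable def stepP (d : ℕ) : ℕ → Zd d → Zd d → ℝ
  | 0, x, y => if x = y then 1 else 0
  | n+1, x, y => (∑ j : Fin d,
      (stepP d n (Function.update x j (x j + 1)) y +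
       stepP d n (Function.update x j (x j - 1)) y)) / (2 * d)

/-- The Green function of simple random walk on `ℤ^d`. -/
noncomputable def green (d : ℕ) (x y : Zd d) : ℝ := ∑' n : ℕ, stepP d n x y

/-- The energy of a (finitely supported) measure `ν`, carried by the finite set `s`. -/
noncomputable def energy (d : ℕ) (s : Finset (Zd d)) (ν : Zd d → ℝ) : ℝ :=
  ∑ z ∈ s, ∑ w ∈ s, green d z w * ν z * ν w

/-- The capacity of `K ⊆ ℤ^d`: the inverse of the infimum of the energies of probability
measures carried by `K` (with the conventions `sInf ∅ = 0`, `0⁻¹ = 0`, this gives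
`capacity d ∅ = 0`). -/
noncomputable def capacity (d : ℕ) (K : Set (Zd d)) : ℝ :=
  (sInf {E : ℝ | ∃ (s : Finset (Zd d)) (ν : Zd d → ℝ), ↑s ⊆ K ∧
    (∀ z, 0 ≤ ν z) ∧ (∀ z ∉ s, ν z = 0) ∧ (∑ z ∈ s, ν z) = 1 ∧ E = energy d s ν})⁻¹

open Classical in
/-- `X` is a simple random walk on `ℤ^d` started at `x0`, under the probability measure `P`:
a walk follows nearest-neighbour paths, each of the `(2d)^n` admissible length-`n` paths from
`x0` having probability `(2d)⁻ⁿ`. -/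
def IsSRW (d : ℕ) {Ω : Type} [MeasurableSpace Ω] (P : Measure Ω)
    (X : ℕ → Ω → Zd d) (x0 : Zd d) : Prop :=
  (∀ t, Measurable (X t)) ∧
  ∀ (n : ℕ) (w : ℕ → Zd d),
    P {ω | ∀ k ≤ n, X k ω = w k} =
      if w 0 = x0 ∧ ∀ k < n, IsStep (w k) (w (k+1))
      then ((2 * d : ℝ≥0∞))⁻¹ ^ n else 0

/-- The set `Φ(X̄_N, T)`: all points visited by the walks `X 0, …, X (N-1)` during times
`1, …, T`. -/
def Phi (d : ℕ) {Ω : Type} (X : ℕ → ℕ → Ω → Zd d) (N T : ℕ) (ω : Ω) : Set (Zd d) :=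
  {z | ∃ i < N, ∃ t, 1 ≤ t ∧ t ≤ T ∧ X i t ω = z}

/-- The function `F(n,d)` : `√n` for `d = 3`, `log n` for `d = 4`, and `1` for `d ≥ 5`. -/
noncomputable def Ffn (d n : ℕ) : ℝ :=
  if d = 3 then Real.sqrt n else if d = 4 then Real.log n else 1
theorem sqrt_taylor (v : ℝ) (h1 : -(1/4) ≤ v) (h2 : v ≤ 1/4) :
    1 + v/2 - v^2/8 + v^3/16 - v^4 ≤ Real.sqrt (1+v) := by
  apply Real.le_sqrt_of_sq_le
  have key : (1+v) - (1 + v/2 - v^2/8 + v^3/16 - v^4)^2 = v^4 * (2 - 5/64 + v * (1 + 1/64) - v^2*(1/4+1/256) + v^3/8 - v^4) := by ring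
  have : 0 ≤ (2 - 5/64 + v * (1 + 1/64) - v^2*(1/4+1/256) + v^3/8 - v^4) := by
    have hv2 : v^2 ≤ 1/16 := by nlinarith
    have hv4 : v^4 ≤ 1/16 := by nlinarith [sq_nonneg v]
    have hv3 : -(1/16) ≤ v^3 := by nlinarith [sq_nonneg v]
    nlinarith
  have := mul_nonneg (by positivity : 0 ≤ v^4) this
  linarith

theorem inv_sqrt_taylor (v : ℝ) (h1 : -(1/4) ≤ v) (h2 : v ≤ 1/4) :
    (Real.sqrt (1+v))⁻¹ ≤ 1 - v/2 + 3*v^2/8 - 5*v^3/16 + v^4 := by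
  have hv2 : v^2 ≤ 1/16 := by nlinarith
  have hv4 : v^4 ≤ 1/16 := by nlinarith [sq_nonneg v]
  have hv3 : -(1/16) ≤ v^3 := by nlinarith [sq_nonneg v]
  have hv3' : v^3 ≤ 1/16 := by nlinarith [sq_nonneg v]
  have hq : 0 < 1 - v/2 + 3*v^2/8 - 5*v^3/16 + v^4 := by nlinarith [sq_nonneg v, sq_nonneg (v^2)]
  rw [inv_le_comm₀ (Real.sqrt_pos.2 (by linarith)) hq]
  apply Real.le_sqrt_of_sq_le
  rw [inv_pow, inv_le_comm₀ (by positivity) (by linarith), inv_le_iff_one_le_mul₀ (by linarith)]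
  have key : (1 - v/2 + 3*v^2/8 - 5*v^3/16 + v^4)^2*(1+v) - 1 = v^4 * (93/64 + v*(39/32) - v^2*(99/256) + v^3*(57/256) + v^4 *(3/8) + v^5) := by ring
  have : 0 ≤ (93/64 + v*(39/32) - v^2*(99/256) + v^3*(57/256) + v^4 *(3/8) + v^5) := by
    have : -(1/16) ≤ v^5 := by nlinarith [sq_nonneg (v^2)]
    nlinarith [sq_nonneg v, sq_nonneg (v^2)]
  have := mul_nonneg (by positivity : 0 ≤ v^4) this
  linarith

theorem sqrt_pair (R s : ℝ) (hR : 0 < R) (hs : |s| ≤ R/4) :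
    Real.sqrt R * (2 - (s/R)^2/4 - 2*(s/R)^4) ≤ Real.sqrt (R+s) + Real.sqrt (R-s) := by
  obtain ⟨h1, h2⟩ := abs_le.1 hs
  have e1 : R + s = R * (1 + s/R) := by field_simp
  have e2 : R - s = R * (1 + -(s/R)) := by field_simp; ring
  have b1 : -(1/4) ≤ s/R := by rw [le_div_iff₀ hR]; linarith
  have b2 : s/R ≤ 1/4 := by rw [div_le_iff₀ hR]; linarith
  rw [e1, e2, Real.sqrt_mul hR.le, Real.sqrt_mul hR.le, ← mul_add]
  apply mul_le_mul_of_nonneg_left _ (Real.sqrt_nonneg _)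
  have := sqrt_taylor _ b1 b2
  have := sqrt_taylor (-(s/R)) (by linarith) (by linarith)
  nlinarith

theorem inv_sqrt_pair (R s : ℝ) (hR : 0 < R) (hs : |s| ≤ R/4) :
    (Real.sqrt (R+s))⁻¹ + (Real.sqrt (R-s))⁻¹ ≤ (Real.sqrt R)⁻¹ * (2 + 3*(s/R)^2/4 + 2*(s/R)^4) := by
  obtain ⟨h1, h2⟩ := abs_le.1 hs
  have e1 : R + s = R * (1 + s/R) := by field_simp
  have e2 : R - s = R * (1 + -(s/R)) := by field_simp; ring
  have b1 : -(1/4) ≤ s/R := by rw [le_div_iff₀ hR]; linarith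
  have b2 : s/R ≤ 1/4 := by rw [div_le_iff₀ hR]; linarith
  rw [e1, e2, Real.sqrt_mul hR.le, Real.sqrt_mul hR.le, mul_inv, mul_inv, ← mul_add]
  apply mul_le_mul_of_nonneg_left _ (inv_nonneg.2 (Real.sqrt_nonneg _))
  have := inv_sqrt_taylor _ b1 b2
  have := inv_sqrt_taylor (-(s/R)) (by linarith) (by linarith)
  nlinarith

theorem lattice_aux (a b c R : ℝ) (hR : R = a^2+b^2+c^2+32) :
    (|2*a| ≤ R/4 ∧ |2*b| ≤ R/4 ∧ |2*c| ≤ R/4) ∧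
    ((2*a/R)^2 + (2*b/R)^2 + (2*c/R)^2 = 4/R - 128/R^2) ∧
    ((2*a/R)^4 + (2*b/R)^4 + (2*c/R)^4 ≤ 16/R^2) := by
  have h0 : 0 < R := by rw [hR]; positivity
  have e : (2*a/R)^2 + (2*b/R)^2 + (2*c/R)^2 = 4/R - 128/R^2 := by
    have : a^2 = R - b^2 - c^2 - 32 := by linarith
    field_simp
    linarith
  refine ⟨⟨?_, ?_, ?_⟩, e, ?_⟩
  · rw [abs_le]; constructor <;> nlinarith [sq_nonneg (a-4), sq_nonneg (a+4), sq_nonneg b, sq_nonneg c]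
  · rw [abs_le]; constructor <;> nlinarith [sq_nonneg (b-4), sq_nonneg (b+4), sq_nonneg a, sq_nonneg c]
  · rw [abs_le]; constructor <;> nlinarith [sq_nonneg (c-4), sq_nonneg (c+4), sq_nonneg b, sq_nonneg a]
  · have h1 : (2*a/R)^2 + (2*b/R)^2 + (2*c/R)^2 ≤ 4/R := by rw [e]; linarith [show 0 ≤ 128/R^2 by positivity]
    have h2 : ((2*a/R)^2 + (2*b/R)^2 + (2*c/R)^2)^2 ≤ (4/R)^2 := by gcongr
    have h3 : (4/R)^2 = 16/R^2 := by field_simp; norm_num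
    nlinarith [mul_nonneg (sq_nonneg (2*a/R)) (sq_nonneg (2*b/R)), mul_nonneg (sq_nonneg (2*a/R)) (sq_nonneg (2*c/R)), mul_nonneg (sq_nonneg (2*c/R)) (sq_nonneg (2*b/R))]

/-- The regularised norm is strictly subharmonic. -/
theorem f_sub (a b c : ℝ) :
    Real.sqrt (a^2+b^2+c^2+31) + (Real.sqrt (a^2+b^2+c^2+31))⁻¹ / 12 ≤
    ((Real.sqrt ((a+1)^2+b^2+c^2+31) + Real.sqrt ((a-1)^2+b^2+c^2+31)) +
     (Real.sqrt (a^2+(b+1)^2+c^2+31) + Real.sqrt (a^2+(b-1)^2+c^2+31)) +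
     (Real.sqrt (a^2+b^2+(c+1)^2+31) + Real.sqrt (a^2+b^2+(c-1)^2+31))) / 6 := by
  obtain ⟨R, hR⟩ : ∃ R, R = a^2+b^2+c^2+32 := ⟨_, rfl⟩
  obtain ⟨⟨ha, hb, hc⟩, e2, e4⟩ := lattice_aux a b c R hR
  have h32 : 32 ≤ R := by rw [hR]; nlinarith [sq_nonneg a, sq_nonneg b, sq_nonneg c]
  have h0 : 0 < R := by linarith
  have pa := sqrt_pair R _ h0 ha
  have pb := sqrt_pair R _ h0 hb
  have pc := sqrt_pair R _ h0 hc
  rw [show a^2+b^2+c^2+31 = R - 1 by linarith,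
    show (a+1)^2+b^2+c^2+31 = R + 2*a by rw [hR]; ring,
    show (a-1)^2+b^2+c^2+31 = R - 2*a by rw [hR]; ring,
    show a^2+(b+1)^2+c^2+31 = R + 2*b by rw [hR]; ring,
    show a^2+(b-1)^2+c^2+31 = R - 2*b by rw [hR]; ring,
    show a^2+b^2+(c+1)^2+31 = R + 2*c by rw [hR]; ring,
    show a^2+b^2+(c-1)^2+31 = R - 2*c by rw [hR]; ring]
  set r := Real.sqrt R with hr
  have hr0 : 0 < r := Real.sqrt_pos.2 h0
  have hrr : r^2 = R := Real.sq_sqrt h0.le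
  have hs : Real.sqrt (R-1) ≤ r * (1 - 1/(2*R)) := by
    apply Real.sqrt_le_iff.2
    have : 1/(2*R) ≤ 1 := by rw [div_le_one (by linarith)]; linarith
    refine ⟨mul_nonneg hr0.le (by linarith), ?_⟩
    rw [mul_pow, hrr]
    have : R * (1-1/(2*R))^2 = R - 1 + 1/(4*R) := by field_simp; ring
    rw [this]; linarith [show 0 ≤ 1/(4*R) by positivity]
  have hi : (Real.sqrt (R-1))⁻¹ ≤ 2 * r⁻¹ := by
    rw [inv_le_comm₀ (Real.sqrt_pos.2 (by linarith)) (by positivity)]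
    apply Real.le_sqrt_of_sq_le
    rw [mul_inv, inv_inv, mul_pow, hrr]; linarith
  have hri : r⁻¹ = r * (1/R) := by rw [← hrr]; field_simp
  have hR2 : 1/R^2 ≤ 1/R * (1/32) := by
    rw [div_mul_div_comm, div_le_div_iff₀ (by positivity) (by positivity)]; nlinarith
  have main : 6 - (4/R - 128/R^2)/4 - 2*(16/R^2) ≥ 6 * (1 - 1/(2*R) + 2*(1/R)/12) := by
    have t1 : 4/R = 4*(1/R) := by ring
    have t2 : 16/R^2 = 16*(1/R^2) := by ring
    have t3 : 1/(2*R) = 1/R/2 := by field_simp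
    have t4 : 128/R^2 = 128*(1/R^2) := by ring
    have : 0 ≤ 1/R^2 := by positivity
    rw [t1,t2,t3,t4]; linarith
  have m2 := mul_le_mul_of_nonneg_left main hr0.le
  have m3 := mul_le_mul_of_nonneg_left e4 hr0.le
  have m4 := congrArg (fun z => r * z) e2
  rw [hri] at hi
  nlinarith

/-- The inverse of the regularised norm is superharmonic. -/
theorem h_super (a b c : ℝ) :
    (((Real.sqrt ((a+1)^2+b^2+c^2+31))⁻¹ + (Real.sqrt ((a-1)^2+b^2+c^2+31))⁻¹) +
     ((Real.sqrt (a^2+(b+1)^2+c^2+31))⁻¹ + (Real.sqrt (a^2+(b-1)^2+c^2+31))⁻¹) +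
     ((Real.sqrt (a^2+b^2+(c+1)^2+31))⁻¹ + (Real.sqrt (a^2+b^2+(c-1)^2+31))⁻¹)) / 6 ≤
    (Real.sqrt (a^2+b^2+c^2+31))⁻¹ := by
  obtain ⟨R, hR⟩ : ∃ R, R = a^2+b^2+c^2+32 := ⟨_, rfl⟩
  obtain ⟨⟨ha, hb, hc⟩, e2, e4⟩ := lattice_aux a b c R hR
  have h32 : 32 ≤ R := by rw [hR]; nlinarith [sq_nonneg a, sq_nonneg b, sq_nonneg c]
  have h0 : 0 < R := by linarith
  have pa := inv_sqrt_pair R _ h0 ha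
  have pb := inv_sqrt_pair R _ h0 hb
  have pc := inv_sqrt_pair R _ h0 hc
  rw [show a^2+b^2+c^2+31 = R - 1 by linarith,
    show (a+1)^2+b^2+c^2+31 = R + 2*a by rw [hR]; ring,
    show (a-1)^2+b^2+c^2+31 = R - 2*a by rw [hR]; ring,
    show a^2+(b+1)^2+c^2+31 = R + 2*b by rw [hR]; ring,
    show a^2+(b-1)^2+c^2+31 = R - 2*b by rw [hR]; ring,
    show a^2+b^2+(c+1)^2+31 = R + 2*c by rw [hR]; ring,
    show a^2+b^2+(c-1)^2+31 = R - 2*c by rw [hR]; ring]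
  set r := Real.sqrt R with hr
  have hr0 : 0 < r := Real.sqrt_pos.2 h0
  have hrr : r^2 = R := Real.sq_sqrt h0.le
  have hs : r⁻¹ * (1 + 1/(2*R)) ≤ (Real.sqrt (R-1))⁻¹ := by
    rw [le_inv_comm₀ (by positivity) (Real.sqrt_pos.2 (by linarith))]
    apply Real.sqrt_le_iff.2
    refine ⟨by positivity, ?_⟩
    rw [mul_inv, inv_inv, mul_pow, hrr, inv_pow, ← div_eq_mul_inv, le_div_iff₀ (by positivity)]
    have : (R-1) * (1+1/(2*R))^2 = R - 3/(4*R) - 1/(4*R^2) := by field_simp; ring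
    rw [this]; linarith [show 0 ≤ 3/(4*R) by positivity, show 0 ≤ 1/(4*R^2) by positivity]
  have main : 6 + 3*(4/R - 128/R^2)/4 + 2*(16/R^2) ≤ 6 * (1 + 1/(2*R)) := by
    have t1 : 4/R = 4*(1/R) := by ring
    have t2 : 16/R^2 = 16*(1/R^2) := by ring
    have t3 : 1/(2*R) = 1/R/2 := by field_simp
    have t4 : 128/R^2 = 128*(1/R^2) := by ring
    have : 0 ≤ 1/R^2 := by positivity
    rw [t1,t2,t3,t4]; linarith
  have hri : 0 ≤ r⁻¹ := by positivity
  have m2 := mul_le_mul_of_nonneg_left main hri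
  have m3 := mul_le_mul_of_nonneg_left e4 hri
  have m4 := congrArg (fun z => r⁻¹ * z) e2
  nlinarith

/-- One-step averaging operator. -/
noncomputable def avg (φ : Zd 3 → ℝ) (x : Zd 3) : ℝ :=
  (∑ j : Fin 3, (φ (Function.update x j (x j + 1)) + φ (Function.update x j (x j - 1)))) / 6

/-- regularised squared distance -/
noncomputable def qd (y x : Zd 3) : ℝ :=
  ((x 0 : ℝ) - y 0)^2 + ((x 1 : ℝ) - y 1)^2 + ((x 2 : ℝ) - y 2)^2 + 31

noncomputable def fd (y x : Zd 3) : ℝ := Real.sqrt (qd y x)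
noncomputable def hd (y x : Zd 3) : ℝ := (Real.sqrt (qd y x))⁻¹

theorem qd_pos (y x) : 0 < qd y x := by unfold qd; positivity
theorem hd_nonneg (y x) : 0 ≤ hd y x := by unfold hd; positivity
theorem fd_nonneg (y x) : 0 ≤ fd y x := by unfold fd; positivity
theorem hd_symm (y x) : hd y x = hd x y := by
  unfold hd qd; congr 2; ring

theorem avg_mono {φ ψ : Zd 3 → ℝ} (h : ∀ x, φ x ≤ ψ x) (x) : avg φ x ≤ avg ψ x := by
  unfold avg; gcongr <;> apply h

theorem avg_nonneg {φ : Zd 3 → ℝ} (h : ∀ x, 0 ≤ φ x) (x) : 0 ≤ avg φ x := by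
  unfold avg
  exact div_nonneg (Finset.sum_nonneg fun j _ => add_nonneg (h _) (h _)) (by norm_num)

theorem avg_iter_mono (n : ℕ) : ∀ {φ ψ : Zd 3 → ℝ}, (∀ x, φ x ≤ ψ x) → ∀ x, (avg^[n] φ) x ≤ (avg^[n] ψ) x := by
  induction n with
  | zero => intro φ ψ h x; exact h x
  | succ n ih => intro φ ψ h x; exact ih (avg_mono h) x

theorem avg_iter_nonneg (n : ℕ) : ∀ {φ : Zd 3 → ℝ}, (∀ x, 0 ≤ φ x) → ∀ x, 0 ≤ (avg^[n] φ) x := by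
  induction n with
  | zero => intro φ h x; exact h x
  | succ n ih => intro φ h x; exact ih (avg_nonneg h) x

theorem avg_lin (α β γ : ℝ) (φ ψ : Zd 3 → ℝ) :
    avg (fun x => α * φ x + β * ψ x + γ) = fun x => α * avg φ x + β * avg ψ x + γ := by
  funext x; simp only [avg, Fin.sum_univ_three]; ring

theorem avg_iter_lin (n : ℕ) : ∀ (α β γ : ℝ) (φ ψ : Zd 3 → ℝ),
    avg^[n] (fun x => α * φ x + β * ψ x + γ) = fun x => α * (avg^[n] φ) x + β * (avg^[n] ψ) x + γ := by
  induction n with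
  | zero => intros; rfl
  | succ n ih => intros; simp only [Function.iterate_succ, Function.comp, avg_lin, ih]

theorem avg_qd (y x) : avg (qd y) x = qd y x + 1 := by
  simp [avg, qd, Fin.sum_univ_three, Function.update]; ring

theorem avg_fd (y x) : fd y x + hd y x / 12 ≤ avg (fd y) x := by
  have := f_sub ((x 0 : ℝ) - y 0) ((x 1 : ℝ) - y 1) ((x 2 : ℝ) - y 2)
  simp [avg, fd, hd, qd, Fin.sum_univ_three, Function.update]
  convert this using 3 <;> ring_nf

theorem avg_hd (y x) : avg (hd y) x ≤ hd y x := by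
  have := h_super ((x 0 : ℝ) - y 0) ((x 1 : ℝ) - y 1) ((x 2 : ℝ) - y 2)
  simp [avg, hd, qd, Fin.sum_univ_three, Function.update]
  convert this using 3 <;> ring_nf

noncomputable def dl : ℝ := (Real.sqrt 31)⁻¹ - (Real.sqrt 32)⁻¹

theorem dl_pos : 0 < dl := by
  unfold dl
  rw [sub_pos]
  apply inv_strictAnti₀ (by positivity)
  exact Real.sqrt_lt_sqrt (by norm_num) (by norm_num)

theorem avg_hd_self (y) : avg (hd y) y = hd y y - dl := by
  simp [avg, hd, qd, dl, Fin.sum_univ_three, Function.update]; norm_num; ring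

theorem stepP_succ (n : ℕ) (x y : Zd 3) : stepP 3 (n+1) x y = avg (fun z => stepP 3 n z y) x := by
  simp only [stepP, avg]; norm_num

theorem stepP_nonneg (n : ℕ) : ∀ x y, 0 ≤ stepP 3 n x y := by
  induction n with
  | zero => intro x y; simp only [stepP]; split_ifs <;> norm_num
  | succ n ih => intro x y; rw [stepP_succ]; exact avg_nonneg (fun z => ih z y) x

theorem sum_stepP (N : ℕ) : ∀ x y, dl * ∑ n ∈ Finset.range N, stepP 3 n x y ≤ hd y x := by
  induction N with
  | zero => intro x y; simpa using hd_nonneg y x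
  | succ N ih =>
    intro x y
    rw [Finset.sum_range_succ', mul_add]
    have h1 : dl * ∑ k ∈ Finset.range N, stepP 3 (k+1) x y =
        avg (fun z => dl * ∑ k ∈ Finset.range N, stepP 3 k z y) x := by
      simp only [stepP_succ, avg, Fin.sum_univ_three]
      rw [← Finset.sum_div]
      simp only [Finset.sum_add_distrib]
      ring
    have h2 := avg_mono (fun z => ih z y) x
    rw [h1]
    by_cases hxy : x = y
    · subst hxy
      rw [avg_hd_self] at h2
      simp only [stepP, if_true]; linarith
    · have := avg_hd y x
      simp only [stepP, if_neg hxy]; linarith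

theorem stepP_summable (x y) : Summable (fun n => stepP 3 n x y) := by
  apply summable_of_sum_range_le (c := hd y x / dl) (fun n => stepP_nonneg n x y)
  intro N
  rw [le_div_iff₀ dl_pos, mul_comm]; exact sum_stepP N x y

theorem green_le (x y) : green 3 x y ≤ hd y x / dl := by
  apply Real.tsum_le_of_sum_range_le (fun n => stepP_nonneg n x y)
  intro N
  rw [le_div_iff₀ dl_pos, mul_comm]; exact sum_stepP N x y

theorem green_nonneg (x y) : 0 ≤ green 3 x y := tsum_nonneg fun n => stepP_nonneg n x y

theorem green_self (x) : 1 ≤ green 3 x x := by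
  have := (stepP_summable x x).le_tsum 0 (fun n _ => stepP_nonneg n x x)
  simpa [stepP, green] using this

theorem qd_iter (y x) (n : ℕ) : (avg^[n] (qd y)) x = qd y x + n := by
  induction n generalizing x with
  | zero => simp
  | succ n ih =>
    rw [Function.iterate_succ_apply']
    have : avg^[n] (qd y) = fun x => 1 * qd y x + 0 * qd y x + n := by funext z; rw [ih]; ring
    rw [this, avg_lin]; simp only []; rw [avg_qd]; push_cast; ring

theorem fd_iter (y) (n : ℕ) : (avg^[n] (fd y)) y ≤ Real.sqrt (n + 31) := by
  set m := Real.sqrt (n+31) with hm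
  have hm0 : 0 < m := Real.sqrt_pos.2 (by positivity)
  have hmm : m^2 = n + 31 := Real.sq_sqrt (by positivity)
  have h : ∀ x, fd y x ≤ (1/(2*m)) * qd y x + 0 * qd y x + m/2 := by
    intro x
    have h2 : (fd y x)^2 = qd y x := Real.sq_sqrt (qd_pos y x).le
    have : (1/(2*m)) * qd y x + 0 * qd y x + m/2 - fd y x = (fd y x - m)^2/(2*m) := by
      rw [← h2]; field_simp; ring
    have : 0 ≤ (fd y x - m)^2/(2*m) := by positivity
    linarith
  refine (avg_iter_mono n h y).trans ?_
  rw [avg_iter_lin]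
  simp only
  rw [qd_iter]
  have : qd y y + n = m^2 := by rw [hmm]; simp [qd]; ring
  rw [this]
  apply le_of_eq; field_simp; ring

theorem hd_iter_sum (y) (N : ℕ) :
    ∑ k ∈ Finset.range N, (avg^[k] (hd y)) y ≤ 12 * Real.sqrt (N + 31) := by
  have : ∀ N : ℕ, fd y y + (1/12) * ∑ k ∈ Finset.range N, (avg^[k] (hd y)) y ≤ (avg^[N] (fd y)) y := by
    intro N
    induction N with
    | zero => simp
    | succ N ih =>
      rw [Finset.sum_range_succ, Function.iterate_succ_apply]
      have h := avg_iter_mono N (φ := fun x => 1 * fd y x + (1/12) * hd y x + 0) (ψ := avg (fd y))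
        (fun x => by have := avg_fd y x; linarith) y
      rw [avg_iter_lin] at h
      simp only at h
      linarith
  have h1 := this N
  have h2 := fd_iter y N
  have h3 := fd_nonneg y y
  linarith

theorem energy_lower (s : Finset (Zd 3)) (ν : Zd 3 → ℝ) (T : ℕ) (hT : s.card ≤ T) (hν : ∀ z, 0 ≤ ν z)
    (h1 : ∑ z ∈ s, ν z = 1) : 1 / (T:ℝ) ≤ energy 3 s ν := by
  have hc := sq_sum_le_card_mul_sum_sq (s := s) (f := ν)
  rw [h1] at hc
  have h2 : ∑ z ∈ s, ν z ^ 2 ≤ energy 3 s ν := by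
    unfold energy
    apply Finset.sum_le_sum
    intro z hz
    have h3 := Finset.single_le_sum (f := fun w => green 3 z w * ν z * ν w)
      (fun w _ => mul_nonneg (mul_nonneg (green_nonneg z w) (hν z)) (hν w)) hz
    refine le_trans ?_ h3
    have := green_self z
    nlinarith [mul_nonneg (hν z) (hν z)]
  have h0 : 0 ≤ ∑ z ∈ s, ν z ^ 2 := Finset.sum_nonneg fun z _ => sq_nonneg _
  have hTT : (s.card : ℝ) ≤ T := by exact_mod_cast hT
  rcases Nat.eq_zero_or_pos T with h | h
  · subst h; simp; linarith
  · rw [div_le_iff₀ (by exact_mod_cast h)]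
    nlinarith

theorem capacity_lower (T : ℕ) (hT : 1 ≤ T) (u : ℕ → Zd 3) :
    (T:ℝ)^2 / (∑ s ∈ Finset.Icc 1 T, ∑ t ∈ Finset.Icc 1 T, hd (u s) (u t) / dl) ≤
      capacity 3 {z | ∃ t, 1 ≤ t ∧ t ≤ T ∧ u t = z} := by
  classical
  have hT0 : (0:ℝ) < T := by exact_mod_cast hT
  set A := Finset.Icc 1 T with hA
  set S := A.image u with hS
  let ν : Zd 3 → ℝ := fun z => ((A.filter (fun t => u t = z)).card : ℝ) / T
  have key : ∀ F : Zd 3 → ℝ, ∑ z ∈ S, F z * ν z = (∑ t ∈ A, F (u t)) / T := by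
    intro F
    rw [Finset.sum_comp F u, Finset.sum_div]
    apply Finset.sum_congr rfl
    intro z _
    simp only [ν, nsmul_eq_mul]; ring
  have hen : energy 3 S ν ≤ (∑ s ∈ A, ∑ t ∈ A, hd (u s) (u t) / dl) / (T:ℝ)^2 := by
    unfold energy
    have : ∀ z ∈ S, ∑ w ∈ S, green 3 z w * ν z * ν w = (∑ t ∈ A, green 3 z (u t)) / T * ν z := by
      intro z _
      rw [← key (fun w => green 3 z w), Finset.sum_mul]
      apply Finset.sum_congr rfl; intro w _; ring
    rw [Finset.sum_congr rfl this, key (fun z => (∑ t ∈ A, green 3 z (u t)) / T), ← Finset.sum_div, div_div, ← sq]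
    gcongr with s _ t _
    rw [hd_symm]; exact green_le _ _
  have hmem : ∃ (s : Finset (Zd 3)) (ν' : Zd 3 → ℝ), ↑s ⊆ {z | ∃ t, 1 ≤ t ∧ t ≤ T ∧ u t = z} ∧
    (∀ z, 0 ≤ ν' z) ∧ (∀ z ∉ s, ν' z = 0) ∧ (∑ z ∈ s, ν' z) = 1 ∧ energy 3 S ν = energy 3 s ν' := by
    refine ⟨S, ν, ?_, ?_, ?_, ?_, rfl⟩
    · intro z hz
      simp only [hS, hA, Finset.coe_image, Set.mem_image, Finset.mem_coe, Finset.mem_Icc] at hz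
      obtain ⟨t, ht, rfl⟩ := hz
      exact ⟨t, ht.1, ht.2, rfl⟩
    · intro z; positivity
    · intro z hz
      have : A.filter (fun t => u t = z) = ∅ := by
        apply Finset.filter_eq_empty_iff.2
        intro t ht h; exact hz (Finset.mem_image.2 ⟨t, ht, h⟩)
      simp [ν, this]
    · have := key (fun _ => 1)
      simp only [one_mul] at this
      rw [this]; simp only [hA, Finset.sum_const, Nat.card_Icc, nsmul_eq_mul, mul_one]; rw [Nat.add_sub_cancel, div_self hT0.ne']
  have hlb : ∀ E ∈ {E : ℝ | ∃ (s : Finset (Zd 3)) (ν : Zd 3 → ℝ), ↑s ⊆ {z | ∃ t, 1 ≤ t ∧ t ≤ T ∧ u t = z} ∧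
    (∀ z, 0 ≤ ν z) ∧ (∀ z ∉ s, ν z = 0) ∧ (∑ z ∈ s, ν z) = 1 ∧ E = energy 3 s ν}, 1/(T:ℝ) ≤ E := by
    rintro E ⟨s, ν', hs, h0, _, h1, rfl⟩
    apply energy_lower s ν' T _ h0 h1
    have : s ⊆ S := by
      intro z hz
      obtain ⟨t, ht1, ht2, rfl⟩ := hs hz
      exact Finset.mem_image_of_mem _ (Finset.mem_Icc.2 ⟨ht1, ht2⟩)
    calc s.card ≤ S.card := Finset.card_le_card this
      _ ≤ A.card := Finset.card_image_le
      _ = T := by simp [hA]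
  have hle : sInf _ ≤ energy 3 S ν := csInf_le ⟨_, fun E hE => hlb E hE⟩ hmem
  have hpos := le_csInf (show Set.Nonempty _ from ⟨energy 3 S ν, hmem⟩) hlb
  unfold capacity
  rw [← inv_div]
  apply inv_anti₀
  · exact lt_of_lt_of_le (by positivity) hpos
  · exact hle.trans hen

/-- `ℝ≥0∞`-valued averaging operator. -/
noncomputable def avgE (g : Zd 3 → ℝ≥0∞) (x : Zd 3) : ℝ≥0∞ :=
  (∑ j : Fin 3, (g (Function.update x j (x j + 1)) + g (Function.update x j (x j - 1)))) * 6⁻¹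

theorem avgE_ofReal (φ : Zd 3 → ℝ) (h : ∀ x, 0 ≤ φ x) (x) :
    avgE (fun y => ENNReal.ofReal (φ y)) x = ENNReal.ofReal (avg φ x) := by
  unfold avgE avg
  rw [div_eq_mul_inv, ENNReal.ofReal_mul (Finset.sum_nonneg fun j _ => add_nonneg (h _) (h _)),
    ENNReal.ofReal_sum_of_nonneg (fun j _ => add_nonneg (h _) (h _)),
    ENNReal.ofReal_inv_of_pos (by norm_num)]
  congr 1
  · exact Finset.sum_congr rfl fun j _ => (ENNReal.ofReal_add (h _) (h _)).symm
  · norm_num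

theorem isStep_cases (b y : Zd 3) (h : IsStep b y) :
    ∃ j : Fin 3, y = Function.update b j (b j + 1) ∨ y = Function.update b j (b j - 1) := by
  unfold IsStep at h
  rw [Fin.sum_univ_three] at h
  have h3 : ((y 0 - b 0).natAbs = 1 ∧ (y 1 - b 1).natAbs = 0 ∧ (y 2 - b 2).natAbs = 0) ∨
      ((y 0 - b 0).natAbs = 0 ∧ (y 1 - b 1).natAbs = 1 ∧ (y 2 - b 2).natAbs = 0) ∨
      ((y 0 - b 0).natAbs = 0 ∧ (y 1 - b 1).natAbs = 0 ∧ (y 2 - b 2).natAbs = 1) := by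
    generalize (y 0 - b 0).natAbs = p at *
    generalize (y 1 - b 1).natAbs = q at *
    generalize (y 2 - b 2).natAbs = r at *
    omega
  have z0 : ∀ u v : ℤ, (u - v).natAbs = 0 → u = v := fun u v h => by omega
  have z1 : ∀ u v : ℤ, (u - v).natAbs = 1 → u = v + 1 ∨ u = v - 1 := fun u v h => by omega
  rcases h3 with ⟨h0, h1, h2⟩ | ⟨h0, h1, h2⟩ | ⟨h0, h1, h2⟩
  · refine ⟨0, (z1 _ _ h0).imp (fun h0 => ?_) (fun h0 => ?_)⟩ <;>
    · funext i; fin_cases i <;> simp [Function.update, h0, z0 _ _ h1, z0 _ _ h2]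
  · refine ⟨1, (z1 _ _ h1).imp (fun h1 => ?_) (fun h1 => ?_)⟩ <;>
    · funext i; fin_cases i <;> simp [Function.update, h1, z0 _ _ h0, z0 _ _ h2]
  · refine ⟨2, (z1 _ _ h2).imp (fun h2 => ?_) (fun h2 => ?_)⟩ <;>
    · funext i; fin_cases i <;> simp [Function.update, h2, z0 _ _ h1, z0 _ _ h0]

open Classical in
theorem tsum_step_le (g : Zd 3 → ℝ≥0∞) (b : Zd 3) :
    ∑' y, g y * (if IsStep b y then (6:ℝ≥0∞)⁻¹ else 0) ≤ avgE g b := by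
  have h1 : ∀ y, g y * (if IsStep b y then (6:ℝ≥0∞)⁻¹ else 0) ≤
      (∑ j : Fin 3, ((if y = Function.update b j (b j + 1) then g y else 0) +
        (if y = Function.update b j (b j - 1) then g y else 0))) * 6⁻¹ := by
    intro y
    by_cases hs : IsStep b y
    · rw [if_pos hs]
      gcongr
      obtain ⟨j, hj⟩ := isStep_cases b y hs
      refine le_trans ?_ (Finset.single_le_sum (f := fun j => ((if y = Function.update b j (b j + 1) then g y else 0) +
        (if y = Function.update b j (b j - 1) then g y else 0))) (fun _ _ => zero_le) (Finset.mem_univ j))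
      rcases hj with hj | hj
      · simp only [if_pos hj]; exact le_self_add
      · simp only [if_pos hj]; exact le_add_self
    · simp [hs]
  refine (ENNReal.tsum_le_tsum h1).trans ?_
  rw [ENNReal.tsum_mul_right]
  unfold avgE
  gcongr
  rw [Summable.tsum_finsetSum (fun _ _ => ENNReal.summable)]
  apply le_of_eq
  apply Finset.sum_congr rfl
  intro j _
  rw [ENNReal.tsum_add, tsum_ite_eq, tsum_ite_eq]

section walk
variable {Ω : Type} [MeasurableSpace Ω] {P : Measure Ω} {X : ℕ → Ω → Zd 3} {x : Zd 3}

theorem markov_cyl (hX : IsSRW 3 P X x) (n : ℕ) (w : ℕ → Zd 3) (g : Zd 3 → ℝ≥0∞) :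
    ∫⁻ ω in {ω | ∀ k ≤ n, X k ω = w k}, g (X (n+1) ω) ∂P ≤
      avgE g (w n) * P {ω | ∀ k ≤ n, X k ω = w k} := by
  classical
  set A := {ω | ∀ k ≤ n, X k ω = w k} with hA
  have hg : Measurable g := Measurable.of_discrete
  rw [← lintegral_map hg (hX.1 (n+1)), lintegral_countable']
  have h6 : (2 * ((3:ℕ):ℝ≥0∞))⁻¹ = 6⁻¹ := by norm_num
  have h1 : ∀ y, ((P.restrict A).map (X (n+1))) {y} ≤ (if IsStep (w n) y then (6:ℝ≥0∞)⁻¹ else 0) * P A := by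
    intro y
    rw [Measure.map_apply (hX.1 _) (measurableSet_singleton y),
      Measure.restrict_apply (hX.1 _ (measurableSet_singleton y))]
    have he : X (n+1) ⁻¹' {y} ∩ A = {ω | ∀ k ≤ n+1, X k ω = Function.update w (n+1) y k} := by
      ext ω
      simp only [Set.mem_inter_iff, Set.mem_preimage, Set.mem_singleton_iff, hA, Set.mem_ofPred_eq]
      constructor
      · rintro ⟨h1, h2⟩ k hk
        rcases Nat.lt_or_ge n k with h | h
        · obtain rfl : k = n+1 := by omega
          simpa using h1
        · rw [Function.update_of_ne (by omega)]; exact h2 k h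
      · intro h
        refine ⟨by simpa using h (n+1) le_rfl, fun k hk => ?_⟩
        have := h k (by omega)
        rwa [Function.update_of_ne (by omega)] at this
    rw [he, hX.2 (n+1), hA, hX.2 n]
    by_cases c1 : Function.update w (n + 1) y 0 = x ∧
        ∀ k < n + 1, IsStep (Function.update w (n + 1) y k) (Function.update w (n + 1) y (k + 1))
    · have c2 : IsStep (w n) y := by
        have := c1.2 n (by omega)
        rwa [Function.update_of_ne (by omega), Function.update_self] at this
      have c3 : w 0 = x ∧ ∀ k < n, IsStep (w k) (w (k + 1)) := by
        refine ⟨by simpa using c1.1, fun k hk => ?_⟩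
        have := c1.2 k (by omega)
        rwa [Function.update_of_ne (by omega), Function.update_of_ne (by omega)] at this
      rw [if_pos c1, if_pos c2, if_pos c3, h6, pow_succ, mul_comm]
    · rw [if_neg c1]; exact zero_le
  calc ∑' a, g a * ((P.restrict A).map (X (n+1))) {a}
      ≤ ∑' a, g a * (if IsStep (w n) a then (6:ℝ≥0∞)⁻¹ else 0) * P A := by
        apply ENNReal.tsum_le_tsum; intro a; rw [mul_assoc]; gcongr; exact h1 a
    _ ≤ _ := by
        rw [ENNReal.tsum_mul_right]; gcongr; exact tsum_step_le g (w n)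

theorem cyl_meas (hX : IsSRW 3 P X x) (n : ℕ) (w : ℕ → Zd 3) :
    MeasurableSet {ω | ∀ k ≤ n, X k ω = w k} := by
  have : {ω | ∀ k ≤ n, X k ω = w k} = ⋂ k, ⋂ (_ : k ≤ n), X k ⁻¹' {w k} := by
    ext ω; simp
  rw [this]
  exact MeasurableSet.iInter fun k => MeasurableSet.iInter fun _ => hX.1 k (measurableSet_singleton _)

theorem markov_step (hX : IsSRW 3 P X x) (s n : ℕ) (hs : s ≤ n) (Φ : Zd 3 → Zd 3 → ℝ≥0∞) :
    ∫⁻ ω, Φ (X s ω) (X (n+1) ω) ∂P ≤ ∫⁻ ω, avgE (Φ (X s ω)) (X n ω) ∂P := by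
  let e : (Fin (n+1) → Zd 3) → ℕ → Zd 3 := fun w k => if h : k < n+1 then w ⟨k, h⟩ else 0
  let A : (Fin (n+1) → Zd 3) → Set Ω := fun w => {ω | ∀ k ≤ n, X k ω = e w k}
  have hAm : ∀ w, MeasurableSet (A w) := fun w => cyl_meas hX n (e w)
  have hd : Pairwise (Function.onFun Disjoint A) := by
    intro w w' hne
    rw [Function.onFun, Set.disjoint_left]
    intro ω h h'
    apply hne
    funext i
    have h1 := h i (by omega)
    have h2 := h' i (by omega)
    rw [h1] at h2
    have hi := i.2
    simp only [e, hi, dif_pos] at h2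
    exact h2
  have hU : ⋃ w, A w = Set.univ := by
    apply Set.eq_univ_of_forall
    intro ω
    rw [Set.mem_iUnion]
    refine ⟨fun i => X i ω, fun k hk => ?_⟩
    simp only [e, dif_pos (Nat.lt_succ_of_le hk)]
  have hdec : ∀ F : Ω → ℝ≥0∞, ∫⁻ ω, F ω ∂P = ∑' w, ∫⁻ ω in A w, F ω ∂P := by
    intro F
    rw [← lintegral_iUnion hAm hd, hU, Measure.restrict_univ]
  rw [hdec, hdec]
  apply ENNReal.tsum_le_tsum
  intro w
  have l1 : ∫⁻ ω in A w, Φ (X s ω) (X (n+1) ω) ∂P = ∫⁻ ω in A w, Φ (e w s) (X (n+1) ω) ∂P := by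
    apply setLIntegral_congr_fun (hAm w)
    intro ω hω
    simp only
    rw [hω s hs]
  have l2 : ∫⁻ ω in A w, avgE (Φ (X s ω)) (X n ω) ∂P = ∫⁻ ω in A w, avgE (Φ (e w s)) (e w n) ∂P := by
    apply setLIntegral_congr_fun (hAm w)
    intro ω hω
    simp only
    rw [hω s hs, hω n le_rfl]
  rw [l1, l2, setLIntegral_const]
  exact markov_cyl hX n (e w) _

theorem markov_iter (hX : IsSRW 3 P X x) (s k : ℕ) : ∀ (φ : Zd 3 → Zd 3 → ℝ), (∀ a b, 0 ≤ φ a b) →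
    ∫⁻ ω, ENNReal.ofReal (φ (X s ω) (X (s+k) ω)) ∂P ≤
      ∫⁻ ω, ENNReal.ofReal ((avg^[k] (φ (X s ω))) (X s ω)) ∂P := by
  induction k with
  | zero => intro φ _; exact le_rfl
  | succ k ih =>
    intro φ h
    refine (markov_step hX s (s+k) (by omega) (fun a b => ENNReal.ofReal (φ a b))).trans ?_
    simp only [avgE_ofReal _ (h _)]
    exact ih (fun a => avg (φ a)) (fun a b => avg_nonneg (h a) b)

theorem double_sum_le (T : ℕ) (H : ℕ → ℕ → ℝ≥0∞) (hs : ∀ s t, H s t = H t s) :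
    ∑ s ∈ Finset.Icc 1 T, ∑ t ∈ Finset.Icc 1 T, H s t ≤
      2 * ∑ s ∈ Finset.Icc 1 T, ∑ k ∈ Finset.range T, H s (s+k) := by
  set A := Finset.Icc 1 T with hA
  have h1 : ∀ s ∈ A, ∑ t ∈ A, (if s ≤ t then H s t else 0) ≤ ∑ k ∈ Finset.range T, H s (s+k) := by
    intro s hsA
    rw [← Finset.sum_filter, ← Finset.sum_image (s := Finset.range T) (g := fun k => s + k) (f := fun t => H s t) (by intro a _ b _ h; simpa using h)]
    apply Finset.sum_le_sum_of_subset
    intro t ht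
    simp only [hA, Finset.mem_filter, Finset.mem_Icc, Finset.mem_image, Finset.mem_range] at ht hsA ⊢
    exact ⟨t - s, by omega, by omega⟩
  have h2 : ∑ s ∈ A, ∑ t ∈ A, H s t ≤ ∑ s ∈ A, ∑ t ∈ A, (if s ≤ t then H s t else 0) +
      ∑ s ∈ A, ∑ t ∈ A, (if t ≤ s then H t s else 0) := by
    rw [← Finset.sum_add_distrib]
    gcongr with s _
    rw [← Finset.sum_add_distrib]
    gcongr with t _
    rcases le_total s t with h | h
    · rw [if_pos h]; exact le_self_add
    · rw [if_pos h, hs]; exact le_add_self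
  rw [Finset.sum_comm (f := fun s t => if t ≤ s then H t s else 0), ← two_mul] at h2
  refine h2.trans ?_
  gcongr with s hsA
  exact h1 s hsA

theorem hd_meas (hX : IsSRW 3 P X x) (s t : ℕ) :
    Measurable fun ω => ENNReal.ofReal (hd (X s ω) (X t ω)) := by
  have hc : ∀ (r : ℕ) (i : Fin 3), Measurable fun ω => ((X r ω i : ℤ) : ℝ) := fun r i =>
    (Measurable.of_discrete (f := fun z : ℤ => (z : ℝ))).comp ((measurable_pi_apply i).comp (hX.1 r))
  unfold hd qd
  refine ENNReal.measurable_ofReal.comp (Measurable.inv (Measurable.sqrt ?_))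
  exact (((((hc t 0).sub (hc s 0)).pow_const 2).add (((hc t 1).sub (hc s 1)).pow_const 2)).add
    (((hc t 2).sub (hc s 2)).pow_const 2)).add_const 31

theorem expect_bound [IsProbabilityMeasure P] (hX : IsSRW 3 P X x) (T : ℕ) (hT : 1 ≤ T) :
    ∫⁻ ω, ∑ s ∈ Finset.Icc 1 T, ∑ t ∈ Finset.Icc 1 T, ENNReal.ofReal (hd (X s ω) (X t ω)) ∂P ≤
      ENNReal.ofReal (144 * T * Real.sqrt T) := by
  have hm : ∀ s t, Measurable fun ω => ENNReal.ofReal (hd (X s ω) (X t ω)) := fun s t =>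
    hd_meas hX s t
  have h1 : ∀ s, ∑ k ∈ Finset.range T, ∫⁻ ω, ENNReal.ofReal (hd (X s ω) (X (s+k) ω)) ∂P ≤
      ENNReal.ofReal (72 * Real.sqrt T) := by
    intro s
    have hT1 : (1:ℝ) ≤ T := by exact_mod_cast hT
    have hsq : Real.sqrt (T + 31) ≤ 6 * Real.sqrt T := by
      apply Real.sqrt_le_iff.2
      refine ⟨by positivity, ?_⟩
      rw [mul_pow, Real.sq_sqrt (by positivity)]; linarith
    calc _ ≤ ∑ k ∈ Finset.range T, ∫⁻ ω, ENNReal.ofReal ((avg^[k] (hd (X s ω))) (X s ω)) ∂P :=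
          Finset.sum_le_sum fun k _ => markov_iter hX s k hd hd_nonneg
      _ = ∫⁻ ω, ∑ k ∈ Finset.range T, ENNReal.ofReal ((avg^[k] (hd (X s ω))) (X s ω)) ∂P := by
          rw [lintegral_finsetSum]
          intro k _
          exact (Measurable.of_discrete (f := fun a : Zd 3 => ENNReal.ofReal ((avg^[k] (hd a)) a))).comp (hX.1 s)
      _ ≤ ∫⁻ ω, ENNReal.ofReal (72 * Real.sqrt T) ∂P := by
          apply lintegral_mono
          intro ω
          simp only
          rw [← ENNReal.ofReal_sum_of_nonneg (fun k _ => avg_iter_nonneg k (hd_nonneg _) _)]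
          apply ENNReal.ofReal_le_ofReal
          have := hd_iter_sum (X s ω) T
          linarith
      _ = _ := by simp
  calc _ ≤ ∫⁻ ω, 2 * ∑ s ∈ Finset.Icc 1 T, ∑ k ∈ Finset.range T, ENNReal.ofReal (hd (X s ω) (X (s+k) ω)) ∂P := by
        apply lintegral_mono
        intro ω
        exact double_sum_le T (fun s t => ENNReal.ofReal (hd (X s ω) (X t ω))) (fun s t => by rw [hd_symm])
    _ = 2 * ∑ s ∈ Finset.Icc 1 T, ∑ k ∈ Finset.range T, ∫⁻ ω, ENNReal.ofReal (hd (X s ω) (X (s+k) ω)) ∂P := by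
        rw [lintegral_const_mul' _ _ (by norm_num), lintegral_finsetSum]
        · congr 1
          apply Finset.sum_congr rfl
          intro s _
          rw [lintegral_finsetSum]
          intro k _; exact hm _ _
        · intro s _
          exact Finset.measurable_sum _ fun k _ => hm _ _
    _ ≤ 2 * ∑ s ∈ Finset.Icc 1 T, ENNReal.ofReal (72 * Real.sqrt T) := by
        gcongr with s _; exact h1 s
    _ = _ := by
        rw [Finset.sum_const, Nat.card_Icc, nsmul_eq_mul, Nat.add_sub_cancel,
          show (2:ℝ≥0∞) = ENNReal.ofReal 2 by norm_num, ← ENNReal.ofReal_natCast T,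
          ← ENNReal.ofReal_mul (by positivity), ← ENNReal.ofReal_mul (by positivity)]
        congr 1; ring

end walk

/-- In dimension `3` there is a constant `c > 0` such that for every `x ∈ ℤ³`, every simple
random walk `X` started at `x` and every positive integer `T`,
`P[cap({X(t) : 1 ≤ t ≤ T}) ≥ c T^{1/2}] ≥ c`. -/
theorem capacity_range_d3 :
    ∃ c : ℝ, 0 < c ∧
    ∀ (Ω : Type) (_ : MeasurableSpace Ω) (P : Measure Ω), IsProbabilityMeasure P →
    ∀ (x : Zd 3) (X : ℕ → Ω → Zd 3), IsSRW 3 P X x →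
    ∀ T : ℕ, 1 ≤ T →
    ENNReal.ofReal c ≤
      P {ω | c * Real.sqrt T ≤ capacity 3 {z | ∃ t, 1 ≤ t ∧ t ≤ T ∧ X t ω = z}} := by
  refine ⟨min (dl/288) (1/2), lt_min (by have := dl_pos; positivity) (by norm_num), ?_⟩
  intro Ω _ P hP x X hX T hT
  have hT0 : (0:ℝ) < T := by exact_mod_cast hT
  have hq0 : 0 < Real.sqrt T := Real.sqrt_pos.2 hT0
  have hqq : Real.sqrt T * Real.sqrt T = T := Real.mul_self_sqrt hT0.le
  have hdl := dl_pos
  let S : Ω → ℝ≥0∞ := fun ω =>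
    ∑ s ∈ Finset.Icc 1 T, ∑ t ∈ Finset.Icc 1 T, ENNReal.ofReal (hd (X s ω) (X t ω))
  have hS : Measurable S := Finset.measurable_sum _ fun s _ => Finset.measurable_sum _ fun t _ =>
    hd_meas hX s t
  set ε : ℝ≥0∞ := ENNReal.ofReal (288 * T * Real.sqrt T) with hε
  have hε0 : ε ≠ 0 := by rw [hε]; simp only [ne_eq, ENNReal.ofReal_eq_zero, not_le]; positivity
  have hmk := (mul_meas_ge_le_lintegral (μ := P) hS ε).trans (expect_bound hX T hT)
  have hhalf : P {ω | ε ≤ S ω} ≤ ENNReal.ofReal (1/2) := by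
    have : ENNReal.ofReal (144 * T * Real.sqrt T) = ε * ENNReal.ofReal (1/2) := by
      rw [hε, ← ENNReal.ofReal_mul (by positivity)]; congr 1; ring
    rw [this] at hmk
    exact (ENNReal.mul_le_mul_iff_right hε0 ENNReal.ofReal_ne_top).1 hmk
  have hcompl : ENNReal.ofReal (1/2) ≤ P {ω | ε ≤ S ω}ᶜ := by
    rw [prob_compl_eq_one_sub (measurableSet_le measurable_const hS)]
    calc ENNReal.ofReal (1/2) = 1 - ENNReal.ofReal (1/2) := by
          rw [← ENNReal.ofReal_one, ← ENNReal.ofReal_sub _ (by norm_num)]; norm_num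
      _ ≤ _ := tsub_le_tsub_left hhalf _
  refine (ENNReal.ofReal_le_ofReal (min_le_right _ _)).trans (hcompl.trans (measure_mono ?_))
  intro ω hω
  simp only [Set.mem_compl_iff, Set.mem_setOf_eq, not_le] at hω ⊢
  have hsum : S ω = ENNReal.ofReal (∑ s ∈ Finset.Icc 1 T, ∑ t ∈ Finset.Icc 1 T, hd (X s ω) (X t ω)) := by
    rw [ENNReal.ofReal_sum_of_nonneg (fun s _ => Finset.sum_nonneg fun t _ => hd_nonneg _ _)]
    apply Finset.sum_congr rfl
    intro s _
    rw [ENNReal.ofReal_sum_of_nonneg (fun t _ => hd_nonneg _ _)]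
  rw [hsum, hε, ENNReal.ofReal_lt_ofReal_iff (by positivity)] at hω
  have hne : (Finset.Icc 1 T).Nonempty := ⟨1, Finset.mem_Icc.2 ⟨le_rfl, hT⟩⟩
  have hpos : 0 < ∑ s ∈ Finset.Icc 1 T, ∑ t ∈ Finset.Icc 1 T, hd (X s ω) (X t ω) :=
    Finset.sum_pos (fun s _ => Finset.sum_pos (fun t _ =>
      inv_pos.2 (Real.sqrt_pos.2 (qd_pos _ _))) hne) hne
  refine le_trans ?_ (capacity_lower T hT (fun t => X t ω))
  simp only [← Finset.sum_div]
  rw [le_div_iff₀ (by positivity)]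
  calc min (dl/288) (1/2) * Real.sqrt T * ((∑ s ∈ Finset.Icc 1 T, ∑ t ∈ Finset.Icc 1 T, hd (X s ω) (X t ω)) / dl)
      ≤ dl/288 * Real.sqrt T * ((288 * T * Real.sqrt T) / dl) := by
        gcongr
        exact min_le_left _ _
    _ = (Real.sqrt T * Real.sqrt T) * T := by field_simp
    _ = (T:ℝ)^2 := by rw [hqq]; ring
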